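/- For every two-qubit quantum state ρ on ℂ² ⊗ ℂ², D(ρ) equals the geometric discord of ρ: D(ρ) = inf { √2·‖ρ − σ‖_F : σ a classical-quantum state on ℂ² ⊗ ℂ² }, where a classical-quantum state is one of the form σ = Σ_{i=1}^2 q_i |a_i⟩⟨a_i| ⊗ σ_i with {|a₁⟩,|a₂⟩} an orthonormal basis of ℂ², {q_i} a probability distribution, and σ_i density matrices on ℂ². -/

import Mathlib

open Matrix Kronecker BigOperators ComplexOrder

noncomputable section

/-- Frobenius (Hilbert–Schmidt) norm of a square complex matrix. -/
def frob {n : Type*} [Fintype n] (A : Matrix n n ℂ) : ℝ :=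
  Real.sqrt (Matrix.trace (Aᴴ * A)).re

/-- Conjugation of a bipartite matrix by `U ⊗ I`. -/
def conjA {M N : ℕ} (U : Matrix (Fin M) (Fin M) ℂ)
    (ρ : Matrix (Fin M × Fin N) (Fin M × Fin N) ℂ) :
    Matrix (Fin M × Fin N) (Fin M × Fin N) ℂ :=
  (U ⊗ₖ (1 : Matrix (Fin N) (Fin N) ℂ)) * ρ * (U ⊗ₖ (1 : Matrix (Fin N) (Fin N) ℂ))ᴴ

/-- The quantity `D(ρ,U) = (1/√2)·‖ρ − (U⊗I) ρ (U⊗I)†‖_F`. -/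
def DU {M N : ℕ} (ρ : Matrix (Fin M × Fin N) (Fin M × Fin N) ℂ)
    (U : Matrix (Fin M) (Fin M) ℂ) : ℝ :=
  (1 / Real.sqrt 2) * frob (ρ - conjA U ρ)

/-- A Root-of-Unity (RU) unitary: a unitary whose eigenvalues, with multiplicity,
are exactly the `M` distinct `M`-th roots of unity. -/
def IsRU {M : ℕ} (U : Matrix (Fin M) (Fin M) ℂ) : Prop :=
  ∃ V ∈ Matrix.unitaryGroup (Fin M) ℂ,
    U = V * Matrix.diagonal (fun k : Fin M =>
      Complex.exp (2 * Real.pi * Complex.I * (((k : ℕ) : ℂ) + 1) / (M : ℂ))) * Vᴴ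

/-- The measure `D(ρ)`: infimum of `D(ρ,U)` over RU unitaries `U`. -/
def Dm {M N : ℕ} (ρ : Matrix (Fin M × Fin N) (Fin M × Fin N) ℂ) : ℝ :=
  sInf {d : ℝ | ∃ U, IsRU U ∧ d = DU ρ U}

/-- A bipartite quantum state: positive semidefinite with unit trace. -/
def IsState {M N : ℕ} (ρ : Matrix (Fin M × Fin N) (Fin M × Fin N) ℂ) : Prop :=
  ρ.PosSemidef ∧ ρ.trace = 1

/-- Partial trace over the second tensor factor. -/
def traceB {M N : ℕ} (ρ : Matrix (Fin M × Fin N) (Fin M × Fin N) ℂ) :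
    Matrix (Fin M) (Fin M) ℂ :=
  Matrix.of fun p q => ∑ j : Fin N, ρ (p, j) (q, j)

/-- Rank-one outer product `|v⟩⟨v|`. -/
def outer {α : Type*} (v : α → ℂ) : Matrix α α ℂ :=
  Matrix.of fun i j => v i * (starRingEnd ℂ) (v j)

/-- The Pauli matrices. -/
def pauli : Fin 3 → Matrix (Fin 2) (Fin 2) ℂ :=
  ![!![0, 1; 1, 0], !![0, -Complex.I; Complex.I, 0], !![1, 0; 0, -1]]


section helpers

variable {M N : ℕ}

theorem frob_eq_sqrt_sum {n : Type*} [Fintype n] (A : Matrix n n ℂ) :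
    frob A = Real.sqrt (∑ p : n × n, ‖A p.1 p.2‖ ^ 2) := by
  unfold frob
  congr 1
  rw [Fintype.sum_prod_type_right]
  simp [Matrix.trace, Matrix.mul_apply, ← Complex.normSq_eq_norm_sq, Complex.normSq_apply]

theorem frob_le_frob {n : Type*} [Fintype n] {A B : Matrix n n ℂ}
    (h : ∀ i j, ‖A i j‖ ≤ ‖B i j‖) : frob A ≤ frob B := by
  rw [frob_eq_sqrt_sum, frob_eq_sqrt_sum]
  gcongr
  exact h _ _

theorem frob_smul {n : Type*} [Fintype n] (c : ℝ) (A : Matrix n n ℂ) :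
    frob (c • A) = |c| * frob A := by
  rw [frob_eq_sqrt_sum, frob_eq_sqrt_sum, ← Real.sqrt_sq_eq_abs,
    ← Real.sqrt_mul (sq_nonneg c), Finset.mul_sum]
  simp [mul_pow]

theorem conjA_mul (U V : Matrix (Fin M) (Fin M) ℂ)
    (ρ : Matrix (Fin M × Fin N) (Fin M × Fin N) ℂ) :
    conjA (U * V) ρ = conjA U (conjA V ρ) := by
  have h : (U * V) ⊗ₖ (1 : Matrix (Fin N) (Fin N) ℂ) = (U ⊗ₖ 1) * (V ⊗ₖ 1) := by
    rw [← Matrix.mul_kronecker_mul, one_mul]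
  simp only [conjA, h, Matrix.conjTranspose_mul, Matrix.mul_assoc]

theorem conjA_one (ρ : Matrix (Fin M × Fin N) (Fin M × Fin N) ℂ) :
    conjA 1 ρ = ρ := by
  simp [conjA]

theorem conjA_sub (U : Matrix (Fin M) (Fin M) ℂ)
    (A B : Matrix (Fin M × Fin N) (Fin M × Fin N) ℂ) :
    conjA U (A - B) = conjA U A - conjA U B := by
  simp [conjA, Matrix.mul_sub, Matrix.sub_mul]

theorem conjA_sum_smul {ι : Type*} (s : Finset ι) (U : Matrix (Fin M) (Fin M) ℂ) (q : ι → ℝ)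
    (A : ι → Matrix (Fin M × Fin N) (Fin M × Fin N) ℂ) :
    conjA U (∑ i ∈ s, q i • A i) = ∑ i ∈ s, q i • conjA U (A i) := by
  simp [conjA, Matrix.mul_sum, Matrix.sum_mul]

theorem conjA_kronecker (U A : Matrix (Fin M) (Fin M) ℂ) (B : Matrix (Fin N) (Fin N) ℂ) :
    conjA U (A ⊗ₖ B) = (U * A * Uᴴ) ⊗ₖ B := by
  rw [conjA, Matrix.conjTranspose_kronecker, ← Matrix.mul_kronecker_mul,
    ← Matrix.mul_kronecker_mul]
  simp

theorem conjA_conjTranspose_self {V : Matrix (Fin M) (Fin M) ℂ}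
    (hV : V ∈ Matrix.unitaryGroup (Fin M) ℂ)
    (ρ : Matrix (Fin M × Fin N) (Fin M × Fin N) ℂ) :
    conjA V (conjA Vᴴ ρ) = ρ := by
  rw [← conjA_mul, ← Matrix.star_eq_conjTranspose, Matrix.mem_unitaryGroup_iff.1 hV, conjA_one]

theorem conjTranspose_kronecker_one_mul_self {V : Matrix (Fin M) (Fin M) ℂ}
    (hV : V ∈ Matrix.unitaryGroup (Fin M) ℂ) :
    (V ⊗ₖ (1 : Matrix (Fin N) (Fin N) ℂ))ᴴ * (V ⊗ₖ (1 : Matrix (Fin N) (Fin N) ℂ)) = 1 := by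
  rw [Matrix.conjTranspose_kronecker, ← Matrix.mul_kronecker_mul,
    ← Matrix.star_eq_conjTranspose V, Matrix.mem_unitaryGroup_iff'.1 hV]
  simp

theorem trace_conjA {V : Matrix (Fin M) (Fin M) ℂ}
    (hV : V ∈ Matrix.unitaryGroup (Fin M) ℂ)
    (ρ : Matrix (Fin M × Fin N) (Fin M × Fin N) ℂ) :
    (conjA V ρ).trace = ρ.trace := by
  rw [conjA, Matrix.trace_mul_comm, ← Matrix.mul_assoc,
    conjTranspose_kronecker_one_mul_self hV, Matrix.one_mul]

theorem frob_conjA {V : Matrix (Fin M) (Fin M) ℂ}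
    (hV : V ∈ Matrix.unitaryGroup (Fin M) ℂ)
    (A : Matrix (Fin M × Fin N) (Fin M × Fin N) ℂ) :
    frob (conjA V A) = frob A := by
  have h : (conjA V A)ᴴ * conjA V A = conjA V (Aᴴ * A) := by
    have hW := conjTranspose_kronecker_one_mul_self (N := N) hV
    simp only [conjA, Matrix.conjTranspose_mul, Matrix.conjTranspose_conjTranspose,
      Matrix.mul_assoc]
    rw [← Matrix.mul_assoc (V ⊗ₖ (1 : Matrix (Fin N) (Fin N) ℂ))ᴴ (V ⊗ₖ 1), hW, Matrix.one_mul]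
  rw [frob, h, trace_conjA hV, frob]

theorem IsState.conjA {V : Matrix (Fin M) (Fin M) ℂ}
    (hV : V ∈ Matrix.unitaryGroup (Fin M) ℂ)
    {ρ : Matrix (Fin M × Fin N) (Fin M × Fin N) ℂ} (hρ : IsState ρ) :
    IsState (conjA V ρ) :=
  ⟨hρ.1.mul_mul_conjTranspose_same _, (trace_conjA hV ρ).trans hρ.2⟩

/-- The block-diagonal part of a bipartite matrix with respect to the first factor. -/
def pinch (ρ : Matrix (Fin M × Fin N) (Fin M × Fin N) ℂ) :
    Matrix (Fin M × Fin N) (Fin M × Fin N) ℂ :=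
  Matrix.of fun p q => if p.1 = q.1 then ρ p q else 0

theorem conjA_diagonal_apply (z : Fin M → ℂ)
    (ρ : Matrix (Fin M × Fin N) (Fin M × Fin N) ℂ) (p q : Fin M × Fin N) :
    conjA (Matrix.diagonal z) ρ p q = z p.1 * ρ p q * star (z q.1) := by
  have h : Matrix.diagonal z ⊗ₖ (1 : Matrix (Fin N) (Fin N) ℂ)
      = Matrix.diagonal fun p : Fin M × Fin N => z p.1 := by
    rw [← Matrix.diagonal_one, Matrix.diagonal_kronecker_diagonal]
    simp
  rw [conjA, h, Matrix.diagonal_conjTranspose, Matrix.mul_diagonal, Matrix.diagonal_mul]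
  rfl

/-- The canonical diagonal RU unitary. -/
def rootDiagonal (M : ℕ) : Matrix (Fin M) (Fin M) ℂ :=
  Matrix.diagonal fun k : Fin M =>
    Complex.exp (2 * Real.pi * Complex.I * (((k : ℕ) : ℂ) + 1) / (M : ℂ))

theorem rootDiagonal_two : rootDiagonal 2 = Matrix.diagonal ![-1, 1] := by
  rw [rootDiagonal]
  congr 1
  funext k
  fin_cases k
  · have h : 2 * (Real.pi : ℂ) * Complex.I * (((0 : ℕ) : ℂ) + 1) / ((2 : ℕ) : ℂ)
        = Real.pi * Complex.I := by
      push_cast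
      ring
    simpa [h] using (congrArg Complex.exp h).trans Complex.exp_pi_mul_I
  · have h : 2 * (Real.pi : ℂ) * Complex.I * (((1 : ℕ) : ℂ) + 1) / ((2 : ℕ) : ℂ)
        = 2 * Real.pi * Complex.I := by
      push_cast
      ring
    simpa [h] using (congrArg Complex.exp h).trans Complex.exp_two_pi_mul_I

theorem DU_rootDiagonal_two (ρ : Matrix (Fin 2 × Fin N) (Fin 2 × Fin N) ℂ) :
    DU ρ (rootDiagonal 2) = Real.sqrt 2 * frob (ρ - pinch ρ) := by
  have h : ρ - conjA (rootDiagonal 2) ρ = (2 : ℝ) • (ρ - pinch ρ) := by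
    ext ⟨i, k⟩ ⟨j, l⟩
    rw [rootDiagonal_two, Matrix.sub_apply, conjA_diagonal_apply]
    fin_cases i <;> fin_cases j <;> simp [pinch] <;> ring
  have h2 : (1 / Real.sqrt 2) * 2 = Real.sqrt 2 := by
    rw [one_div_mul_eq_div, Real.div_sqrt]
  rw [DU, h, frob_smul, abs_two, ← mul_assoc, h2]

theorem DU_conj {V : Matrix (Fin M) (Fin M) ℂ}
    (hV : V ∈ Matrix.unitaryGroup (Fin M) ℂ) (Z : Matrix (Fin M) (Fin M) ℂ)
    (ρ : Matrix (Fin M × Fin N) (Fin M × Fin N) ℂ) :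
    DU ρ (V * Z * Vᴴ) = DU (conjA Vᴴ ρ) Z := by
  rw [DU, DU, conjA_mul, conjA_mul, ← frob_conjA hV (conjA Vᴴ ρ - _), conjA_sub,
    conjA_conjTranspose_self hV]

theorem sum_smul_single_kronecker_apply (q : Fin M → ℝ) (τ : Fin M → Matrix (Fin N) (Fin N) ℂ)
    (p r : Fin M × Fin N) :
    (∑ i, q i • (Matrix.single i i (1 : ℂ) ⊗ₖ τ i)) p r
      = if p.1 = r.1 then q p.1 • τ p.1 p.2 r.2 else 0 := by
  rw [Matrix.sum_apply, Finset.sum_eq_single p.1]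
  · simp [Matrix.single_apply, Matrix.kroneckerMap_apply]
  · intro i _ hi
    simp [Matrix.kroneckerMap_apply, hi]
  · simp

theorem frob_sub_pinch_le (ρ : Matrix (Fin M × Fin N) (Fin M × Fin N) ℂ)
    (q : Fin M → ℝ) (τ : Fin M → Matrix (Fin N) (Fin N) ℂ) :
    frob (ρ - pinch ρ) ≤ frob (ρ - ∑ i, q i • (Matrix.single i i (1 : ℂ) ⊗ₖ τ i)) := by
  refine frob_le_frob fun p r => ?_
  rw [Matrix.sub_apply, Matrix.sub_apply, sum_smul_single_kronecker_apply]
  by_cases h : p.1 = r.1 <;> simp [pinch, h]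

theorem exists_smul_state_of_posSemidef [NeZero N] {A : Matrix (Fin N) (Fin N) ℂ}
    (hA : A.PosSemidef) :
    ∃ τ : Matrix (Fin N) (Fin N) ℂ, (τ.PosSemidef ∧ τ.trace = 1) ∧ A.trace.re • τ = A := by
  obtain ⟨hre, him⟩ := Complex.nonneg_iff.1 hA.trace_nonneg
  have htr : (A.trace.re : ℂ) = A.trace := Complex.ext rfl him
  by_cases h : A.trace.re = 0
  · have hA0 : A = 0 := hA.trace_eq_zero_iff.1 (by rw [← htr, h, Complex.ofReal_zero])
    exact ⟨Matrix.diagonal (Pi.single 0 1),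
      ⟨Matrix.PosSemidef.diagonal (Pi.single_nonneg.2 zero_le_one), by simp⟩, by simp [hA0]⟩
  · refine ⟨A.trace.re⁻¹ • A, ⟨hA.smul (inv_nonneg.2 hre), ?_⟩, smul_inv_smul₀ h A⟩
    rw [Matrix.trace_smul, ← htr, Complex.ofReal_re, Complex.real_smul, ← Complex.ofReal_mul,
      inv_mul_cancel₀ h, Complex.ofReal_one]

theorem exists_sum_eq_pinch [NeZero N] {ρ : Matrix (Fin M × Fin N) (Fin M × Fin N) ℂ}
    (hρ : IsState ρ) :
    ∃ (q : Fin M → ℝ) (τ : Fin M → Matrix (Fin N) (Fin N) ℂ),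
      (∀ i, 0 ≤ q i) ∧ (∑ i, q i = 1) ∧ (∀ i, (τ i).PosSemidef ∧ (τ i).trace = 1) ∧
      ∑ i, q i • (Matrix.single i i (1 : ℂ) ⊗ₖ τ i) = pinch ρ := by
  have hblock (i : Fin M) :
      (ρ.submatrix (fun k : Fin N => (i, k)) (fun k => (i, k))).PosSemidef := hρ.1.submatrix _
  choose τ hτ hq using fun i => exists_smul_state_of_posSemidef (hblock i)
  refine ⟨_, τ, fun i => (Complex.nonneg_iff.1 (hblock i).trace_nonneg).1, ?_, hτ, ?_⟩
  · have h := congrArg Complex.re hρ.2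
    simpa [Matrix.trace, Fintype.sum_prod_type] using h
  · ext p r
    rw [sum_smul_single_kronecker_apply, pinch, Matrix.of_apply]
    split_ifs with h
    · have := congrFun₂ (hq p.1) p.2 r.2
      rw [Matrix.smul_apply, Matrix.submatrix_apply] at this
      rw [this, Prod.mk.eta, h]
    · rfl

theorem mul_single_mul_conjTranspose (V : Matrix (Fin M) (Fin M) ℂ) (i : Fin M) :
    V * Matrix.single i i (1 : ℂ) * Vᴴ = outer (Vᵀ i) := by
  ext j k
  simp [outer, Matrix.mul_apply, Matrix.single_apply, ite_and]

theorem mem_unitaryGroup_iff_orthonormal_columns (V : Matrix (Fin M) (Fin M) ℂ) :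
    V ∈ Matrix.unitaryGroup (Fin M) ℂ ↔
      ∀ i j, dotProduct (star (Vᵀ i)) (Vᵀ j) = if i = j then 1 else 0 := by
  rw [Matrix.mem_unitaryGroup_iff', ← Matrix.ext_iff]
  rfl

theorem frob_sub_sum_outer {V : Matrix (Fin M) (Fin M) ℂ}
    (hV : V ∈ Matrix.unitaryGroup (Fin M) ℂ)
    (ρ : Matrix (Fin M × Fin N) (Fin M × Fin N) ℂ)
    (q : Fin M → ℝ) (τ : Fin M → Matrix (Fin N) (Fin N) ℂ) :
    frob (ρ - ∑ i, q i • (outer (Vᵀ i) ⊗ₖ τ i))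
      = frob (conjA Vᴴ ρ - ∑ i, q i • (Matrix.single i i (1 : ℂ) ⊗ₖ τ i)) := by
  simp_rw [← frob_conjA hV (conjA Vᴴ ρ - _), conjA_sub, conjA_conjTranspose_self hV,
    conjA_sum_smul, conjA_kronecker, mul_single_mul_conjTranspose]

theorem DU_conj_rootDiagonal_two {V : Matrix (Fin 2) (Fin 2) ℂ}
    (hV : V ∈ Matrix.unitaryGroup (Fin 2) ℂ)
    (ρ : Matrix (Fin 2 × Fin N) (Fin 2 × Fin N) ℂ) :
    DU ρ (V * rootDiagonal 2 * Vᴴ)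
      = Real.sqrt 2 * frob (conjA Vᴴ ρ - pinch (conjA Vᴴ ρ)) := by
  rw [DU_conj hV, DU_rootDiagonal_two]

end helpers

/-- For every two-qubit state `ρ`, `D(ρ)` equals the geometric discord:
the infimum of `√2·‖ρ − σ‖_F` over classical-quantum states
`σ = Σ_i q_i |a_i⟩⟨a_i| ⊗ σ_i`. -/
theorem D_eq_geometric_discord
    (ρ : Matrix (Fin 2 × Fin 2) (Fin 2 × Fin 2) ℂ) (hρ : IsState ρ) :
    Dm ρ = sInf {x : ℝ |
      ∃ (q : Fin 2 → ℝ) (a : Fin 2 → Fin 2 → ℂ) (τ : Fin 2 → Matrix (Fin 2) (Fin 2) ℂ),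
        (∀ i, 0 ≤ q i) ∧ (∑ i, q i = 1) ∧
        (∀ i j, dotProduct (star (a i)) (a j) = if i = j then 1 else 0) ∧
        (∀ i, (τ i).PosSemidef ∧ (τ i).trace = 1) ∧
        x = Real.sqrt 2 * frob (ρ - ∑ i, q i • (outer (a i) ⊗ₖ τ i))} := by
  apply le_antisymm
  · refine le_csInf ?_ ?_
    · obtain ⟨q, τ, hq, hsum, hτ, -⟩ := exists_sum_eq_pinch hρ
      exact ⟨_, q, (1 : Matrix (Fin 2) (Fin 2) ℂ)ᵀ, τ, hq, hsum,
        (mem_unitaryGroup_iff_orthonormal_columns 1).1 (one_mem _), hτ, rfl⟩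
    · rintro _ ⟨q, a, τ, -, -, ha, -, rfl⟩
      have hV : (Matrix.of a)ᵀ ∈ Matrix.unitaryGroup (Fin 2) ℂ :=
        (mem_unitaryGroup_iff_orthonormal_columns _).2 ha
      calc Dm ρ ≤ DU ρ ((Matrix.of a)ᵀ * rootDiagonal 2 * (Matrix.of a)ᵀᴴ) :=
            csInf_le ⟨0, ?_⟩ ⟨_, ⟨_, hV, rfl⟩, rfl⟩
        _ = _ := DU_conj_rootDiagonal_two hV ρ
        _ ≤ _ := ?_
      · rintro _ ⟨U, -, rfl⟩
        exact mul_nonneg (by positivity) (Real.sqrt_nonneg _)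
      · have h := frob_sub_sum_outer hV ρ q τ
        simp only [Matrix.transpose_transpose] at h
        gcongr
        exact (frob_sub_pinch_le _ q τ).trans_eq h.symm
  · refine le_csInf ⟨_, _, ⟨1, one_mem _, rfl⟩, rfl⟩ ?_
    rintro _ ⟨_, ⟨V, hV, rfl⟩, rfl⟩
    obtain ⟨q, τ, hq, hsum, hτ, hpinch⟩ :=
      exists_sum_eq_pinch (hρ.conjA (V := Vᴴ) (Unitary.star_mem hV))
    refine csInf_le ⟨0, ?_⟩ ⟨q, Vᵀ, τ, hq, hsum,
      (mem_unitaryGroup_iff_orthonormal_columns V).1 hV, hτ, ?_⟩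
    · rintro _ ⟨q, a, τ, -, -, -, -, rfl⟩
      exact mul_nonneg (Real.sqrt_nonneg _) (Real.sqrt_nonneg _)
    · rw [frob_sub_sum_outer hV, hpinch]
      exact DU_conj_rootDiagonal_two hV ρ

end
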